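/- arXiv:1909.00172 — 3 statements merged into one kernel-verified Lean document; each statement's English description precedes it below -/
import Mathlib

section
/- Let R be the commutative ring ℚ[x₀, x₁, x₂, …, z] / (xᵢ·z : i ∈ ℕ), the quotient of the polynomial ring over ℚ in countably many variables xᵢ (i ∈ ℕ) and one further variable z by the ideal generated by all products xᵢ·z. Then the annihilator of the class of z in R, i.e. the ideal { r ∈ R : z·r = 0 }, equals the ideal of R generated by the residue classes of the xᵢ, i ∈ ℕ. -/
open MvPolynomial

noncomputable section

/-- The polynomial ring `ℚ[x₀, x₁, x₂, …, z]` in countably many variables `xᵢ` and one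
further variable `z`. -/
abbrev PolyRing : Type := MvPolynomial (ℕ ⊕ Unit) ℚ

/-- The ideal generated by the products `xᵢ · z`, `i ∈ ℕ`. -/
def relIdeal : Ideal PolyRing :=
  Ideal.span (Set.range fun i : ℕ => X (Sum.inl i) * X (Sum.inr ()))

/-- The ring `R = ℚ[x₀, x₁, x₂, …, z] / (xᵢ·z : i ∈ ℕ)`. -/
abbrev Rring : Type := PolyRing ⧸ relIdeal

/-- The residue class of the variable `xᵢ` in `R`. -/
def xcl (i : ℕ) : Rring := Ideal.Quotient.mk relIdeal (X (Sum.inl i))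

/-- The residue class of the variable `z` in `R`. -/
def zcl : Rring := Ideal.Quotient.mk relIdeal (X (Sum.inr ()))

/-- A variable outside `s` is a nonzerodivisor modulo the ideal generated by the variables
in `s`. -/
theorem mem_span_X_image_of_X_mul_mem {σ A : Type*} [CommSemiring A] {s : Set σ} {j : σ}
    (hj : j ∉ s) {p : MvPolynomial σ A}
    (hp : X j * p ∈ Ideal.span (X '' s : Set (MvPolynomial σ A))) :
    p ∈ Ideal.span (X '' s : Set (MvPolynomial σ A)) := by
  rw [mem_ideal_span_X_image] at hp ⊢
  intro m hm
  obtain ⟨i, hi, hne⟩ := hp (Finsupp.single j 1 + m) (by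
    rwa [mem_support_iff, coeff_X_mul, ← mem_support_iff])
  have hij : j ≠ i := fun h => hj (h ▸ hi)
  exact ⟨i, hi, by simpa [Finsupp.single_eq_of_ne' hij] using hne⟩

theorem relIdeal_le_span_X : relIdeal ≤ Ideal.span (X '' Set.range Sum.inl) := by
  rw [relIdeal, Ideal.span_le]
  rintro _ ⟨i, rfl⟩
  exact Ideal.mul_mem_right _ _ (Ideal.subset_span ⟨_, ⟨i, rfl⟩, rfl⟩)

theorem map_span_X_eq_span_xcl :
    (Ideal.span (X '' Set.range Sum.inl)).map (Ideal.Quotient.mk relIdeal) =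
      Ideal.span (Set.range xcl) := by
  rw [Ideal.map_span, ← Set.range_comp, ← Set.range_comp]
  rfl

theorem zcl_mul_xcl (i : ℕ) : zcl * xcl i = 0 := by
  rw [zcl, xcl, ← map_mul, Ideal.Quotient.eq_zero_iff_mem, mul_comm]
  exact Ideal.subset_span ⟨i, rfl⟩

/-- In `R = ℚ[x₀, x₁, …, z]/(xᵢ·z)`, the annihilator of (the class of) `z` is the ideal
generated by the residue classes of the `xᵢ`. -/
theorem annihilator_z_eq_span_x (r : Rring) :
    zcl * r = 0 ↔ r ∈ Ideal.span (Set.range xcl) := by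
  constructor
  · obtain ⟨p, rfl⟩ := Ideal.Quotient.mk_surjective r
    intro h
    rw [zcl, ← map_mul, Ideal.Quotient.eq_zero_iff_mem] at h
    rw [← map_span_X_eq_span_xcl]
    exact Ideal.mem_map_of_mem _
      (mem_span_X_image_of_X_mul_mem (by simp) (relIdeal_le_span_X h))
  · intro h
    induction h using Submodule.span_induction with
    | mem x hx =>
      obtain ⟨i, rfl⟩ := hx
      exact zcl_mul_xcl i
    | zero => exact mul_zero _
    | add x y _ _ hx hy => rw [mul_add, hx, hy, add_zero]
    | smul a x _ hx => rw [smul_eq_mul, mul_left_comm, hx, mul_zero]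

end
end

section
/- Let R be the commutative ring ℚ[x₀, x₁, x₂, …, z] / (xᵢ·z : i ∈ ℕ). Then the ideal { r ∈ R : z·r = 0 } (the kernel of the R-linear map R → R, r ↦ z·r) is not finitely generated as an R-module. In particular, the kernel of an R-linear map between finitely generated free R-modules need not be finitely generated, so R is not a coherent ring. -/
open MvPolynomial

noncomputable section

/-- A commutative ring is coherent if kernels of linear maps between finitely generated
free modules are finitely generated. -/
def IsCoherentRing (R : Type*) [CommRing R] : Prop :=
  ∀ (n m : ℕ) (f : (Fin n → R) →ₗ[R] (Fin m → R)), (LinearMap.ker f).FG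

/-- Evaluation of `R` at a point where all products `xᵢ · z` vanish. -/
def evalQuot {A : Type} [CommRing A] [Algebra ℚ A] (a : ℕ ⊕ Unit → A)
    (ha : ∀ i, a (Sum.inl i) * a (Sum.inr ()) = 0) : Rring →+* A :=
  Ideal.Quotient.lift relIdeal (aeval a).toRingHom <| by
    suffices h : relIdeal ≤ RingHom.ker (aeval (R := ℚ) a).toRingHom from fun p hp => h hp
    rw [relIdeal, Ideal.span_le]
    rintro _ ⟨i, rfl⟩
    simpa [RingHom.mem_ker] using ha i

theorem evalQuot_mk {A : Type} [CommRing A] [Algebra ℚ A] (a : ℕ ⊕ Unit → A)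
    (ha : ∀ i, a (Sum.inl i) * a (Sum.inr ()) = 0) (p : PolyRing) :
    evalQuot a ha (Ideal.Quotient.mk relIdeal p) = aeval a p := rfl

theorem mk_X_mem_ker (i : ℕ) :
    Ideal.Quotient.mk relIdeal (X (Sum.inl i)) ∈
      LinearMap.ker (LinearMap.lsmul Rring Rring zcl) := by
  rw [LinearMap.mem_ker, LinearMap.lsmul_apply, smul_eq_mul, zcl, ← map_mul,
    Ideal.Quotient.eq_zero_iff_mem, mul_comm]
  exact Ideal.subset_span ⟨i, rfl⟩

/-- A representative of an element annihilated by `z` has no constant term. -/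
theorem aeval_zero_of_mem_ker {p : PolyRing}
    (hp : Ideal.Quotient.mk relIdeal p ∈ LinearMap.ker (LinearMap.lsmul Rring Rring zcl)) :
    aeval (0 : ℕ ⊕ Unit → ℚ) p = 0 := by
  let a : ℕ ⊕ Unit → Polynomial ℚ := Sum.elim 0 fun _ => Polynomial.X
  have hz : aeval a p = 0 := by
    have h := congrArg (evalQuot a (by simp [a])) (LinearMap.mem_ker.mp hp)
    rw [LinearMap.lsmul_apply, smul_eq_mul, zcl, ← map_mul, evalQuot_mk, map_zero, map_mul,
      aeval_X] at h
    exact (mul_eq_zero.mp h).resolve_left Polynomial.X_ne_zero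
  have hcomp : (Polynomial.aeval (0 : ℚ)).comp (aeval a) = aeval (0 : ℕ ⊕ Unit → ℚ) := by
    ext (i | i) <;> simp [a]
  rw [← hcomp, AlgHom.comp_apply, hz, map_zero]

theorem not_fg_ker_lsmul_zcl : ¬ (LinearMap.ker (LinearMap.lsmul Rring Rring zcl)).FG := by
  classical
  rintro ⟨S, hS⟩
  let lift : Rring → PolyRing := Function.surjInv Ideal.Quotient.mk_surjective
  have hlift : ∀ r, Ideal.Quotient.mk relIdeal (lift r) = r :=
    Function.surjInv_eq Ideal.Quotient.mk_surjective
  obtain ⟨n, hn⟩ := Infinite.exists_notMem_finset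
    ((S.biUnion fun r => (lift r).vars).preimage Sum.inl Sum.inl_injective.injOn)
  let a : ℕ ⊕ Unit → ℚ := Pi.single (Sum.inl n) 1
  let ψ : Rring →+* ℚ := evalQuot a (by simp [a])
  have hle : LinearMap.ker (LinearMap.lsmul Rring Rring zcl) ≤ RingHom.ker ψ := by
    rw [← hS, Submodule.span_le]
    intro r hr
    have hker : r ∈ LinearMap.ker (LinearMap.lsmul Rring Rring zcl) :=
      hS ▸ Submodule.subset_span hr
    rw [← hlift r] at hker
    rw [SetLike.mem_coe, RingHom.mem_ker, ← hlift r, evalQuot_mk,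
      ← aeval_zero_of_mem_ker hker]
    refine eval₂Hom_congr' rfl (fun i hi _ => ?_) rfl
    refine Pi.single_eq_of_ne ?_ _
    rintro rfl
    exact hn (Finset.mem_preimage.mpr (Finset.mem_biUnion.mpr ⟨r, hr, hi⟩))
  have h := RingHom.mem_ker.mp (hle (mk_X_mem_ker n))
  rw [evalQuot_mk, aeval_X] at h
  simp [a] at h

theorem IsCoherentRing.fg_ker_lsmul {R : Type*} [CommRing R] (hR : IsCoherentRing R) (r : R) :
    (LinearMap.ker (LinearMap.lsmul R R r)).FG := by
  have h := (hR 1 1 (LinearMap.lsmul R (Fin 1 → R) r)).map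
    (LinearMap.proj (R := R) (φ := fun _ : Fin 1 => R) 0)
  convert h
  ext s
  simp only [Submodule.mem_map, LinearMap.mem_ker, LinearMap.lsmul_apply]
  constructor
  · exact fun hs => ⟨fun _ => s, funext fun _ => hs, rfl⟩
  · rintro ⟨v, hv, rfl⟩
    exact congrFun hv 0

/-- In `R = ℚ[x₀, x₁, …, z]/(xᵢ·z)`, the kernel of the `R`-linear map `R → R`, `r ↦ z·r`
(i.e. the annihilator ideal of `z`) is not finitely generated as an `R`-module.
In particular `R` is not a coherent ring. -/
theorem annihilator_z_not_fg :
    ¬ (LinearMap.ker (LinearMap.lsmul Rring Rring zcl)).FG ∧ ¬ IsCoherentRing Rring :=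
  ⟨not_fg_ker_lsmul_zcl, fun h => not_fg_ker_lsmul_zcl (h.fg_ker_lsmul zcl)⟩

end
end

section
/- Let R be the commutative ring ℚ[x₀, x₁, x₂, …, z] / (xᵢ·z : i ∈ ℕ). Then the R-module Hom_R(R ⧸ (z), R) of R-linear maps from R ⧸ Ideal.span {z} to R is isomorphic to the ideal of R generated by the residue classes of the xᵢ, and it is not a finitely presented R-module (indeed not even finitely generated). -/
open MvPolynomial

noncomputable section

theorem xcl_mul_zcl (i : ℕ) : xcl i * zcl = 0 := by
  rw [xcl, zcl, ← map_mul, Ideal.Quotient.eq_zero_iff_mem]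
  exact Ideal.subset_span ⟨i, rfl⟩

theorem relIdeal_eq_mul :
    relIdeal = Ideal.span (Set.range fun i : ℕ => (X (Sum.inl i) : PolyRing)) *
      Ideal.span {X (Sum.inr ())} := by
  rw [Ideal.span_mul_span', Set.mul_singleton, ← Set.range_comp]
  rfl

/-- The annihilator of `z` in `R` is the ideal generated by the `xᵢ`. -/
theorem mul_zcl_eq_zero_iff (a : Rring) :
    a * zcl = 0 ↔ a ∈ Ideal.span (Set.range xcl) := by
  constructor
  · intro h
    obtain ⟨p, rfl⟩ := Ideal.Quotient.mk_surjective a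
    rw [zcl, ← map_mul, Ideal.Quotient.eq_zero_iff_mem, relIdeal_eq_mul,
      Ideal.mem_mul_span_singleton] at h
    obtain ⟨q, hq, hqp⟩ := h
    obtain rfl : q = p := mul_right_cancel₀ (X_ne_zero _) hqp
    have := Ideal.mem_map_of_mem (Ideal.Quotient.mk relIdeal) hq
    rwa [Ideal.map_span, ← Set.range_comp] at this
  · intro h
    have hle : Ideal.span (Set.range xcl) ≤ LinearMap.ker (LinearMap.mulRight Rring zcl) := by
      rw [Ideal.span_le]
      rintro _ ⟨i, rfl⟩
      exact xcl_mul_zcl i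
    exact hle h

/-- Evaluating at `1` identifies `Hom_R(R/(z), R)` with the ideal generated by the `xᵢ`. -/
def homQuotientEquiv : ((Rring ⧸ Ideal.span {zcl}) →ₗ[Rring] Rring) ≃ₗ[Rring]
    (Ideal.span (Set.range xcl) : Ideal Rring) :=
  LinearEquiv.ofBijective
    ((LinearMap.applyₗ (1 : Rring ⧸ Ideal.span {zcl})).codRestrict
      (Ideal.span (Set.range xcl)) fun f => by
        have hz : zcl • (1 : Rring ⧸ Ideal.span {zcl}) = 0 :=
          (Submodule.Quotient.mk_eq_zero _).2 <|
            Ideal.mul_mem_right 1 _ (Ideal.mem_span_singleton_self zcl)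
        rw [← mul_zcl_eq_zero_iff, mul_comm, ← smul_eq_mul, LinearMap.applyₗ_apply_apply,
          ← map_smul, hz, map_zero]) <| by
    constructor
    · intro f g h
      refine Submodule.linearMap_qext _ (LinearMap.ext_ring ?_)
      exact congrArg Subtype.val h
    · rintro ⟨a, ha⟩
      refine ⟨Submodule.liftQ _ (LinearMap.toSpanSingleton Rring Rring a) ?_, ?_⟩
      · rw [Ideal.span, Submodule.span_singleton_le_iff_mem, LinearMap.mem_ker,
          LinearMap.toSpanSingleton_apply, smul_eq_mul, mul_comm]
        exact (mul_zcl_eq_zero_iff a).2 ha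
      · refine Subtype.ext ?_
        exact one_smul Rring a

/-- The evaluation of `R` at the point with `xₙ = 1` and all other coordinates `0`. -/
def evalAt (n : ℕ) : Rring →+* ℚ :=
  Ideal.Quotient.lift relIdeal (eval (Pi.single (Sum.inl n) 1)) fun a ha => by
    have hle : relIdeal ≤ RingHom.ker (eval (Pi.single (Sum.inl n) (1 : ℚ))) := by
      rw [relIdeal, Ideal.span_le]
      rintro _ ⟨i, rfl⟩
      simp [RingHom.mem_ker]
    exact hle ha

theorem evalAt_xcl (n i : ℕ) : evalAt n (xcl i) = if i = n then 1 else 0 :=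
  (Ideal.Quotient.lift_mk _ _ _).trans (by simp [Pi.single_apply])

theorem not_fg_span_range_xcl : ¬ (Ideal.span (Set.range xcl)).FG := by
  classical
  intro h
  obtain ⟨s, hs, hspan⟩ := Submodule.fg_span_iff_fg_span_finset_subset _ |>.1 h
  obtain ⟨t, -, hst⟩ := Finset.subset_set_image_iff.1 (Set.image_univ ▸ hs)
  obtain ⟨n, hn⟩ := Infinite.exists_notMem_finset t
  have hle : Ideal.span (Set.range xcl) ≤ RingHom.ker (evalAt n) := by
    refine hspan.trans_le (Ideal.span_le.2 ?_)
    intro a ha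
    obtain ⟨i, hi, rfl⟩ := Finset.mem_image.1 (hst ▸ ha)
    have hin : i ≠ n := fun h => hn (h ▸ hi)
    simp [RingHom.mem_ker, evalAt_xcl, hin]
  have h1 := hle (Ideal.subset_span ⟨n, rfl⟩)
  simp [RingHom.mem_ker, evalAt_xcl] at h1

/-- For `R = ℚ[x₀, x₁, …, z]/(xᵢ·z)`, the `R`-module `Hom_R(R/(z), R)` is isomorphic to the
ideal of `R` generated by the residue classes of the `xᵢ`, and it is neither finitely
generated nor finitely presented as an `R`-module. -/
theorem hom_quotient_z_to_R_not_finitely_presented :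
    Nonempty (((Rring ⧸ Ideal.span {zcl}) →ₗ[Rring] Rring) ≃ₗ[Rring]
        (Ideal.span (Set.range xcl) : Ideal Rring)) ∧
    ¬ Module.Finite Rring ((Rring ⧸ Ideal.span {zcl}) →ₗ[Rring] Rring) ∧
    ¬ Module.FinitePresentation Rring ((Rring ⧸ Ideal.span {zcl}) →ₗ[Rring] Rring) := by
  have hfin : ¬ Module.Finite Rring ((Rring ⧸ Ideal.span {zcl}) →ₗ[Rring] Rring) := fun _ =>
    not_fg_span_range_xcl (Module.Finite.iff_fg.1 (Module.Finite.equiv homQuotientEquiv))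
  exact ⟨⟨homQuotientEquiv⟩, hfin, fun _ => hfin inferInstance⟩

end
end
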